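/- Assume the state-evolution fixed-point setup: σ : (0, ∞) → (0, ∞) is differentiable and satisfies σ(β)² = σ_w² + (1/δ)·E[(η(X + σ(β)Z; β·σ(β)) − X)²] for every β > 0. Then the detection probability β ↦ P(|X + σ(β)·Z| > β·σ(β)) is strictly decreasing in β; that is, d/dβ P(|X + σ(β)Z| > β·σ(β)) < 0 for every β > 0. -/

import Mathlib

open MeasureTheory

/-- Standard Gaussian density `φ(z) = e^{-z²/2}/√(2π)`. -/
noncomputable def gaussPDF (z : ℝ) : ℝ := Real.exp (-z ^ 2 / 2) / Real.sqrt (2 * Real.pi)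

/-- Soft-thresholding function `η(x; τ) = sign(x)·max(|x| − τ, 0)`. -/
noncomputable def softThr (x τ : ℝ) : ℝ := Real.sign x * max (|x| - τ) 0

/-- Soft-thresholding risk `r(τ; G) = E_{μ∼G, Z∼N(0,1)}[(η(μ + Z; τ) − μ)²]`. -/
noncomputable def stRisk (G : Measure ℝ) (τ : ℝ) : ℝ :=
  ∫ m, (∫ z, (softThr (m + z) τ - m) ^ 2 * gaussPDF z) ∂G

lemma gp_eq (z : ℝ) : gaussPDF z = Real.exp (-(1/2) * z ^ 2) / Real.sqrt (2 * Real.pi) := by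
  unfold gaussPDF; congr 2; ring

lemma gp_pos (z : ℝ) : 0 < gaussPDF z := by unfold gaussPDF; positivity

lemma gp_neg (z : ℝ) : gaussPDF (-z) = gaussPDF z := by simp [gaussPDF]

lemma gp_le (z : ℝ) : gaussPDF z ≤ 1 := by
  unfold gaussPDF
  rw [div_le_one (by positivity)]
  have h1 : Real.exp (-z ^ 2 / 2) ≤ 1 := Real.exp_le_one_iff.2 (by nlinarith [sq_nonneg z])
  have h2 : (1:ℝ) ≤ Real.sqrt (2 * Real.pi) := by
    rw [Real.one_le_sqrt]; nlinarith [Real.pi_gt_three]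
  linarith

lemma gp_abs (z : ℝ) : |gaussPDF z| ≤ 1 := by rw [abs_of_pos (gp_pos z)]; exact gp_le z

lemma gp_cont : Continuous gaussPDF := by unfold gaussPDF; fun_prop

lemma gp_deriv (z : ℝ) : HasDerivAt gaussPDF (-z * gaussPDF z) z := by
  unfold gaussPDF
  have h : HasDerivAt (fun z : ℝ => -z ^ 2 / 2) (-z) z := by
    have := ((hasDerivAt_pow 2 z).neg).div_const 2
    exact this.congr_deriv (by simp; ring)
  exact (h.exp.div_const (Real.sqrt (2 * Real.pi))).congr_deriv (by ring)

lemma gp_int : Integrable gaussPDF := by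
  have := (integrable_exp_neg_mul_sq (b := 1/2) (by norm_num)).div_const (Real.sqrt (2 * Real.pi))
  exact this.congr (Filter.Eventually.of_forall fun z => (gp_eq z).symm)

lemma gp_int1 : Integrable (fun z => z * gaussPDF z) := by
  have := (integrable_mul_exp_neg_mul_sq (b := 1/2) (by norm_num)).div_const (Real.sqrt (2 * Real.pi))
  refine this.congr (Filter.Eventually.of_forall fun z => ?_)
  simp only [gp_eq]; ring

lemma gp_int2 : Integrable (fun z => z ^ 2 * gaussPDF z) := by
  have := (integrable_rpow_mul_exp_neg_mul_sq (b := 1/2) (by norm_num) (s := 2) (by norm_num)).div_const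
    (Real.sqrt (2 * Real.pi))
  refine this.congr (Filter.Eventually.of_forall fun z => ?_)
  simp only [gp_eq, Real.rpow_two]; ring

lemma gp_one : ∫ z, gaussPDF z = 1 := by
  simp only [gp_eq]
  rw [integral_div, integral_gaussian]
  rw [show Real.pi / (1/2) = 2 * Real.pi by ring]
  exact div_self (by positivity)

noncomputable def gT (a : ℝ) : ℝ := ∫ z in Set.Ioi a, gaussPDF z

lemma gT_nonneg (a : ℝ) : 0 ≤ gT a := setIntegral_nonneg measurableSet_Ioi fun z _ => (gp_pos z).le

lemma gT_Iio (a : ℝ) : ∫ z in Set.Iio (-a), gaussPDF z = gT a := by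
  rw [← integral_Iic_eq_integral_Iio, ← integral_comp_neg_Ioi]
  simp only [gp_neg, gT]

lemma gT_add_neg (a : ℝ) : gT a + gT (-a) = 1 := by
  rw [← gT_Iio (-a), neg_neg, ← gp_one, ← integral_Iic_eq_integral_Iio, gT, add_comm,
    ← Set.compl_Iic]
  exact integral_add_compl measurableSet_Iic gp_int

lemma gT_anti : Antitone gT := fun a b h =>
  setIntegral_mono_set gp_int.integrableOn (Filter.Eventually.of_forall fun z => (gp_pos z).le)
    (Set.Ioi_subset_Ioi h).eventuallyLE

lemma gT_deriv (a : ℝ) : HasDerivAt gT (-gaussPDF a) a := by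
  have h : gT = fun b => gT (a - 1) - ∫ z in (a-1)..b, gaussPDF z := by
    funext b
    rcases le_total (a-1) b with h | h
    · rw [← intervalIntegral.integral_Ioi_sub_Ioi gp_int.integrableOn h]; simp [gT]
    · rw [intervalIntegral.integral_symm,
        ← intervalIntegral.integral_Ioi_sub_Ioi gp_int.integrableOn h]; simp [gT]
  rw [h]
  exact (intervalIntegral.integral_hasDerivAt_right gp_int.intervalIntegrable
    gp_cont.aestronglyMeasurable.stronglyMeasurableAtFilter gp_cont.continuousAt).const_sub _

lemma gT_cont : Continuous gT := continuous_iff_continuousAt.2 fun a => (gT_deriv a).continuousAt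

/-- sum of tails -/
noncomputable def gQ (m β : ℝ) : ℝ := gT (β - m) + gT (β + m)

lemma gQ_nonneg (m β : ℝ) : 0 ≤ gQ m β := add_nonneg (gT_nonneg _) (gT_nonneg _)

lemma gT_le (a : ℝ) : gT a ≤ 1 := by linarith [gT_add_neg a, gT_nonneg (-a)]

lemma gQ_le (m β : ℝ) : gQ m β ≤ 2 := by unfold gQ; linarith [gT_le (β - m), gT_le (β + m)]

lemma gQ_le_one (m β : ℝ) (hβ : 0 ≤ β) : gQ m β ≤ 1 := by
  unfold gQ
  have := gT_add_neg (β + m)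
  have := gT_anti (show -(β+m) ≤ β - m by linarith)
  linarith

lemma diff_nonneg (m β : ℝ) (hβ : 0 ≤ β) : 0 ≤ m * (gaussPDF (β - m) - gaussPDF (β + m)) := by
  have key : ∀ a b : ℝ, a ^ 2 ≤ b ^ 2 → gaussPDF b ≤ gaussPDF a := by
    intro a b h; unfold gaussPDF; gcongr
  rcases le_total 0 m with h | h
  · exact mul_nonneg h (sub_nonneg.2 (key _ _ (by nlinarith)))
  · exact mul_nonneg_of_nonpos_of_nonpos h (sub_nonpos.2 (key _ _ (by nlinarith)))

lemma key_ineq (m β : ℝ) (hβ : 0 ≤ β) :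
    m * (gaussPDF (β - m) - gaussPDF (β + m)) ≤ m ^ 2 * (1 - gQ m β) := by
  set H : ℝ → ℝ := fun β => m ^ 2 * (1 - gQ m β) - m * (gaussPDF (β - m) - gaussPDF (β + m)) with hH
  have hd : ∀ b, HasDerivAt H (b * (m * (gaussPDF (b - m) - gaussPDF (b + m)))) b := by
    intro b
    have e1 := (gT_deriv (b - m)).comp_sub_const b m
    have e2 := (gT_deriv (b + m)).comp_add_const b m
    have f1 := (gp_deriv (b - m)).comp_sub_const b m
    have f2 := (gp_deriv (b + m)).comp_add_const b m
    exact ((((e1.add e2).const_sub 1).const_mul (m^2)).sub ((f1.sub f2).const_mul m)).congr_deriv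
      (by ring)
  have hm : MonotoneOn H (Set.Ici 0) := by
    apply monotoneOn_of_deriv_nonneg (convex_Ici 0)
    · exact fun b _ => (hd b).continuousAt.continuousWithinAt
    · exact fun b _ => (hd b).differentiableAt.differentiableWithinAt
    · intro b hb
      rw [interior_Ici, Set.mem_Ioi] at hb
      rw [(hd b).deriv]
      exact mul_nonneg hb.le (diff_nonneg m b hb.le)
  have h0 := hm (Set.mem_Ici.2 le_rfl) (Set.mem_Ici.2 hβ) hβ
  have : H 0 = 0 := by
    simp only [hH, gQ, zero_sub, zero_add, gp_neg, sub_self]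
    rw [add_comm, gT_add_neg]; simp
  rw [this] at h0
  simp only [hH] at h0
  linarith

lemma det_inner (m β : ℝ) (hβ : 0 ≤ β) :
    ∫ z in {z : ℝ | β < |m + z|}, gaussPDF z = gQ m β := by
  have : {z : ℝ | β < |m + z|} = Set.Ioi (β - m) ∪ Set.Iio (-(β + m)) := by
    ext z; simp only [Set.mem_ofPred_eq, lt_abs, Set.mem_union, Set.mem_Ioi, Set.mem_Iio]
    constructor <;> (rintro (h | h) <;> [left; right] <;> linarith)
  rw [this, setIntegral_union _ measurableSet_Iio gp_int.integrableOn gp_int.integrableOn, gT_Iio]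
  · rfl
  · rw [Set.disjoint_left]; intro z h1 h2; simp only [Set.mem_Ioi, Set.mem_Iio] at h1 h2; linarith

lemma gp_int_poly (a b c : ℝ) : Integrable (fun z => (a * z ^ 2 + b * z + c) * gaussPDF z) := by
  refine (((gp_int2.const_mul a).add (gp_int1.const_mul b)).add (gp_int.const_mul c)).congr
    (Filter.Eventually.of_forall fun z => ?_)
  simp only [Pi.add_apply]; ring

lemma gp_int_J (β m : ℝ) : Integrable (fun z => ((z - β) ^ 2 - m ^ 2) * gaussPDF z) :=
  (gp_int_poly 1 (-2*β) (β^2 - m^2)).congr (Filter.Eventually.of_forall fun z => by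
    simp only []; ring)

lemma gp_tend (c : ℝ) : Filter.Tendsto (fun z => -((z - c) * gaussPDF z)) Filter.atTop (nhds 0) := by
  have h1 := (tendsto_rpow_abs_mul_exp_neg_mul_sq_cocompact (a := 1/2) (by norm_num) 1).mono_left
    atTop_le_cocompact
  have h0 := (tendsto_rpow_abs_mul_exp_neg_mul_sq_cocompact (a := 1/2) (by norm_num) 0).mono_left
    atTop_le_cocompact
  have := ((h1.sub (h0.const_mul c)).div_const (Real.sqrt (2 * Real.pi))).neg
  simp only [mul_zero, sub_zero, zero_div, neg_zero] at this
  refine this.congr' ?_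
  filter_upwards [Filter.eventually_gt_atTop 0] with z hz
  rw [gp_eq, abs_of_pos hz, Real.rpow_one, Real.rpow_zero]; ring

lemma J_eval (β m a : ℝ) : ∫ z in Set.Ioi a, ((z - β) ^ 2 - m ^ 2) * gaussPDF z
    = (1 + β ^ 2 - m ^ 2) * gT a + (a - 2 * β) * gaussPDF a := by
  have hd : ∀ z, HasDerivAt (fun z => -((z - 2 * β) * gaussPDF z))
      ((1 * z ^ 2 + (-2 * β) * z + (-1)) * gaussPDF z) z := by
    intro z
    exact ((((hasDerivAt_id z).sub_const (2*β)).mul (gp_deriv z)).neg).congr_deriv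
      (by simp only [id]; ring)
  have h := integral_Ioi_of_hasDerivAt_of_tendsto (a := a) (hd a).continuousAt.continuousWithinAt
    (fun z _ => hd z) (gp_int_poly _ _ _).integrableOn (gp_tend (2*β))
  have : ∀ z, ((z - β) ^ 2 - m ^ 2) * gaussPDF z = (1 + β ^ 2 - m ^ 2) * gaussPDF z +
      (1 * z ^ 2 + (-2 * β) * z + (-1)) * gaussPDF z := fun z => by ring
  simp only [this]
  rw [integral_add (gp_int.const_mul _).integrableOn (gp_int_poly _ _ _).integrableOn, h,
    integral_const_mul]
  simp only [gT]; ring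

noncomputable def gr (m β : ℝ) : ℝ := m ^ 2 + (1 + β ^ 2 - m ^ 2) * gQ m β
  - (β + m) * gaussPDF (β - m) - (β - m) * gaussPDF (β + m)

lemma risk_inner (m β : ℝ) (hβ : 0 < β) :
    ∫ z, (softThr (m + z) β - m) ^ 2 * gaussPDF z = gr m β := by
  have hpt : ∀ z, (softThr (m + z) β - m) ^ 2 * gaussPDF z = m ^ 2 * gaussPDF z +
      (Set.Ioi (β - m)).indicator (fun z => ((z - β) ^ 2 - m ^ 2) * gaussPDF z) z +
      (Set.Iio (-(β + m))).indicator (fun z => ((z - (-β)) ^ 2 - m ^ 2) * gaussPDF z) z := by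
    intro z
    simp only [Set.indicator_apply, Set.mem_Ioi, Set.mem_Iio, softThr]
    by_cases h1 : β - m < z
    · have h2 : ¬ z < -(β + m) := by linarith
      rw [if_pos h1, if_neg h2, Real.sign_of_pos (by linarith), abs_of_pos (by linarith),
        max_eq_left (by linarith)]
      ring
    · by_cases h2 : z < -(β + m)
      · rw [if_neg h1, if_pos h2, Real.sign_of_neg (by linarith), abs_of_neg (by linarith),
          max_eq_left (by linarith)]
        ring
      · rw [if_neg h1, if_neg h2, max_eq_right]
        · ring
        · rw [sub_nonpos, abs_le]; constructor <;> linarith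
  simp only [hpt]
  have i1 : Integrable (fun z => m ^ 2 * gaussPDF z +
      (Set.Ioi (β - m)).indicator (fun z => ((z - β) ^ 2 - m ^ 2) * gaussPDF z) z) :=
    (gp_int.const_mul _).add ((gp_int_J β m).indicator measurableSet_Ioi)
  rw [integral_add i1
      ((gp_int_J (-β) m).indicator measurableSet_Iio),
    integral_add (gp_int.const_mul _) ((gp_int_J β m).indicator measurableSet_Ioi),
    integral_indicator measurableSet_Ioi, integral_indicator measurableSet_Iio, J_eval,
    integral_const_mul, gp_one, ← integral_Iic_eq_integral_Iio, ← integral_comp_neg_Ioi]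
  have : ∀ z, ((-z - -β) ^ 2 - m ^ 2) * gaussPDF (-z) = ((z - β) ^ 2 - m ^ 2) * gaussPDF z := by
    intro z; rw [gp_neg]; ring
  simp only [this]
  rw [J_eval, gr, gQ]; ring

lemma softThr_scale (s y τ : ℝ) (hs : 0 < s) : softThr (s * y) (τ * s) = s * softThr y τ := by
  unfold softThr
  have h1 : Real.sign (s * y) = Real.sign y := by
    rcases lt_trichotomy y 0 with h | h | h
    · rw [Real.sign_of_neg h, Real.sign_of_neg (mul_neg_of_pos_of_neg hs h)]
    · simp [h]
    · rw [Real.sign_of_pos h, Real.sign_of_pos (mul_pos hs h)]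
  rw [h1, abs_mul, abs_of_pos hs, show s * |y| - τ * s = s * (|y| - τ) by ring,
    show max (s * (|y| - τ)) 0 = s * max (|y| - τ) 0 by
      rw [mul_max_of_nonneg _ _ hs.le, mul_zero]]
  ring

lemma risk_scaled (x s β : ℝ) (hs : 0 < s) (hβ : 0 < β) :
    ∫ z, (softThr (x + s * z) (β * s) - x) ^ 2 * gaussPDF z = s ^ 2 * gr (x * s⁻¹) β := by
  rw [← risk_inner _ _ hβ, ← integral_const_mul]
  congr 1; funext z
  have : x + s * z = s * (x * s⁻¹ + z) := by field_simp
  rw [this, softThr_scale _ _ _ hs]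
  have : s * softThr (x * s⁻¹ + z) β - x = s * (softThr (x * s⁻¹ + z) β - x * s⁻¹) := by
    field_simp
  rw [this]; ring

lemma det_scaled (x s β : ℝ) (hs : 0 < s) (hβ : 0 < β) :
    ∫ z in {z : ℝ | β * s < |x + s * z|}, gaussPDF z = gQ (x * s⁻¹) β := by
  rw [← det_inner _ _ hβ.le]
  congr 2
  ext z
  have : x + s * z = s * (x * s⁻¹ + z) := by field_simp
  simp only [Set.mem_ofPred_eq]
  rw [this, abs_mul, abs_of_pos hs, mul_comm β s, mul_lt_mul_iff_right₀ hs]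

lemma gQ_fd (x : ℝ) (v : ℝ × ℝ) : HasFDerivAt (fun v : ℝ × ℝ => gQ (x * v.1) v.2)
    ((x * (gaussPDF (v.2 - x * v.1) - gaussPDF (v.2 + x * v.1))) • ContinuousLinearMap.fst ℝ ℝ ℝ
      + (-(gaussPDF (v.2 - x * v.1) + gaussPDF (v.2 + x * v.1))) • ContinuousLinearMap.snd ℝ ℝ ℝ) v := by
  have h1 : HasFDerivAt (fun v : ℝ × ℝ => v.1) (ContinuousLinearMap.fst ℝ ℝ ℝ) v := hasFDerivAt_fst
  have h2 : HasFDerivAt (fun v : ℝ × ℝ => v.2) (ContinuousLinearMap.snd ℝ ℝ ℝ) v := hasFDerivAt_snd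
  have p := (gT_deriv (v.2 - x * v.1)).comp_hasFDerivAt v (h2.sub (h1.const_mul x))
  have n := (gT_deriv (v.2 + x * v.1)).comp_hasFDerivAt v (h2.add (h1.const_mul x))
  refine (p.add n).congr_fderiv ?_
  ext <;> simp <;> ring

lemma gr_fd (x : ℝ) (v : ℝ × ℝ) : HasFDerivAt (fun v : ℝ × ℝ => gr (x * v.1) v.2)
    ((2 * x ^ 2 * v.1 * (1 - gQ (x * v.1) v.2)) • ContinuousLinearMap.fst ℝ ℝ ℝ
      + (2 * (v.2 * gQ (x * v.1) v.2 - (gaussPDF (v.2 - x * v.1) + gaussPDF (v.2 + x * v.1)))) •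
        ContinuousLinearMap.snd ℝ ℝ ℝ) v := by
  have h1 : HasFDerivAt (fun v : ℝ × ℝ => v.1) (ContinuousLinearMap.fst ℝ ℝ ℝ) v := hasFDerivAt_fst
  have h2 : HasFDerivAt (fun v : ℝ × ℝ => v.2) (ContinuousLinearMap.snd ℝ ℝ ℝ) v := hasFDerivAt_snd
  have hm := h1.const_mul x
  have p := (gp_deriv (v.2 - x * v.1)).comp_hasFDerivAt v (h2.sub hm)
  have n := (gp_deriv (v.2 + x * v.1)).comp_hasFDerivAt v (h2.add hm)
  have q := gQ_fd x v
  refine ((((hm.pow 2).add ((((h2.pow 2).const_add 1).sub (hm.pow 2)).mul q)).sub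
    ((h2.add hm).mul p)).sub ((h2.sub hm).mul n)).congr_fderiv ?_
  ext <;> simp <;> ring

lemma gen_deriv (G : Measure ℝ) (f a b : ℝ × ℝ → ℝ → ℝ) (bound : ℝ → ℝ) (t : ℝ → ℝ) (t' β : ℝ)
    (ht : HasDerivAt t t' β)
    (hfd : ∀ v x, HasFDerivAt (fun v => f v x)
      (a v x • ContinuousLinearMap.fst ℝ ℝ ℝ + b v x • ContinuousLinearMap.snd ℝ ℝ ℝ) v)
    (hf : ∀ v, Continuous (f v)) (ha : ∀ v, Continuous (a v)) (hb : ∀ v, Continuous (b v))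
    (hfi : Integrable (f (t β, β)) G) (hbi : Integrable bound G)
    (hbd : ∀ v ∈ Metric.ball (t β, β) 1, ∀ x, |a v x| + |b v x| ≤ bound x) :
    Integrable (a (t β, β)) G ∧ Integrable (b (t β, β)) G ∧
    HasDerivAt (fun β => ∫ x, f (t β, β) x ∂G)
      (t' * ∫ x, a (t β, β) x ∂G + ∫ x, b (t β, β) x ∂G) β := by
  have hmem : (t β, β) ∈ Metric.ball (t β, β) 1 := Metric.mem_ball_self one_pos
  have hai : Integrable (a (t β, β)) G := hbi.mono' (ha _).aestronglyMeasurable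
    (Filter.Eventually.of_forall fun x => by
      have := hbd _ hmem x
      rw [Real.norm_eq_abs]; linarith [abs_nonneg (b (t β, β) x)])
  have hbi' : Integrable (b (t β, β)) G := hbi.mono' (hb _).aestronglyMeasurable
    (Filter.Eventually.of_forall fun x => by
      have := hbd _ hmem x
      rw [Real.norm_eq_abs]; linarith [abs_nonneg (a (t β, β) x)])
  refine ⟨hai, hbi', ?_⟩
  have := hasFDerivAt_integral_of_dominated_of_fderiv_le (μ := G) (𝕜 := ℝ) (F := f)
    (F' := fun v x => a v x • ContinuousLinearMap.fst ℝ ℝ ℝ + b v x • ContinuousLinearMap.snd ℝ ℝ ℝ)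
    (x₀ := (t β, β)) (bound := bound) (Metric.ball_mem_nhds _ one_pos)
    (Filter.Eventually.of_forall fun v => (hf v).aestronglyMeasurable) hfi
    (((ha _).smul continuous_const).add ((hb _).smul continuous_const)).aestronglyMeasurable
    (Filter.Eventually.of_forall fun x v hv => by
      refine le_trans (norm_add_le _ _) (le_trans (add_le_add ?_ ?_) (hbd v hv x))
      · rw [norm_smul, Real.norm_eq_abs]
        exact mul_le_of_le_one_right (abs_nonneg _) (ContinuousLinearMap.norm_fst_le ..)
      · rw [norm_smul, Real.norm_eq_abs]
        exact mul_le_of_le_one_right (abs_nonneg _) (ContinuousLinearMap.norm_snd_le ..))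
    hbi (Filter.Eventually.of_forall fun x v _ => hfd v x)
  rw [integral_add (hai.smul_const _) (hbi'.smul_const _), integral_smul_const,
    integral_smul_const] at this
  have h2 := this.comp_hasDerivAt (f := fun β => (t β, β)) β (ht.prodMk (hasDerivAt_id β))
  exact h2.congr_deriv (by simp; ring)

lemma gQ_cont (t β : ℝ) : Continuous (fun x => gQ (x * t) β) := by
  unfold gQ
  exact (gT_cont.comp (by fun_prop)).add (gT_cont.comp (by fun_prop))

lemma gp_cont' (t β : ℝ) : Continuous (fun x => gaussPDF (β - x * t)) := gp_cont.comp (by fun_prop)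

lemma gp_cont'' (t β : ℝ) : Continuous (fun x => gaussPDF (β + x * t)) := gp_cont.comp (by fun_prop)

lemma ball_bd (v w : ℝ × ℝ) (h : v ∈ Metric.ball w 1) : |v.1| ≤ |w.1| + 1 ∧ |v.2| ≤ |w.2| + 1 := by
  rw [Metric.mem_ball, Prod.dist_eq, max_lt_iff, Real.dist_eq, Real.dist_eq] at h
  have h1 := abs_sub_abs_le_abs_sub v.1 w.1
  have h2 := abs_sub_abs_le_abs_sub v.2 w.2
  constructor <;> linarith

lemma gQ_abs (m β : ℝ) : |gQ m β| ≤ 2 := by rw [abs_of_nonneg (gQ_nonneg m β)]; exact gQ_le m β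

lemma one_sub_gQ_abs (m β : ℝ) : |1 - gQ m β| ≤ 1 := by
  rw [abs_le]; constructor <;> linarith [gQ_nonneg m β, gQ_le m β]

lemma int_abs (G : Measure ℝ) [IsProbabilityMeasure G] (hX : Integrable (fun x => x ^ 2) G) :
    Integrable (fun x : ℝ => |x|) G := by
  refine ((integrable_const (1:ℝ)).add hX).mono' (continuous_abs.aestronglyMeasurable)
    (Filter.Eventually.of_forall fun x => ?_)
  simp only [Real.norm_eq_abs, abs_abs, Pi.add_apply]
  nlinarith [sq_abs x, sq_nonneg (|x| - 1)]

lemma derivQ (G : Measure ℝ) [IsProbabilityMeasure G] (hX : Integrable (fun x => x ^ 2) G)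
    (t : ℝ → ℝ) (t' β : ℝ) (ht : HasDerivAt t t' β) :
    Integrable (fun x => x * (gaussPDF (β - x * t β) - gaussPDF (β + x * t β))) G ∧
    Integrable (fun x => -(gaussPDF (β - x * t β) + gaussPDF (β + x * t β))) G ∧
    HasDerivAt (fun β => ∫ x, gQ (x * t β) β ∂G)
      (t' * ∫ x, x * (gaussPDF (β - x * t β) - gaussPDF (β + x * t β)) ∂G +
        ∫ x, -(gaussPDF (β - x * t β) + gaussPDF (β + x * t β)) ∂G) β := by
  refine gen_deriv G (fun v x => gQ (x * v.1) v.2)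
    (fun v x => x * (gaussPDF (v.2 - x * v.1) - gaussPDF (v.2 + x * v.1)))
    (fun v x => -(gaussPDF (v.2 - x * v.1) + gaussPDF (v.2 + x * v.1)))
    (fun x => |x| * 2 + 2) t t' β ht (fun v x => gQ_fd x v) (fun v => gQ_cont _ _)
    (fun v => continuous_id.mul ((gp_cont' _ _).sub (gp_cont'' _ _)))
    (fun v => ((gp_cont' _ _).add (gp_cont'' _ _)).neg) ?_
    (((int_abs G hX).mul_const 2).add (integrable_const _)) ?_
  · exact (integrable_const (2:ℝ)).mono' (gQ_cont _ _).aestronglyMeasurable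
      (Filter.Eventually.of_forall fun x => gQ_abs _ _)
  · intro v _ x
    rw [abs_mul, abs_neg]
    have := gp_abs (v.2 - x * v.1)
    have := gp_abs (v.2 + x * v.1)
    have := abs_sub (gaussPDF (v.2 - x * v.1)) (gaussPDF (v.2 + x * v.1))
    have := abs_add_le (gaussPDF (v.2 - x * v.1)) (gaussPDF (v.2 + x * v.1))
    have := mul_le_mul_of_nonneg_left (show |gaussPDF (v.2 - x * v.1) - gaussPDF (v.2 + x * v.1)| ≤ 2 by linarith) (abs_nonneg x)
    linarith

lemma gr_int (G : Measure ℝ) [IsProbabilityMeasure G] (hX : Integrable (fun x => x ^ 2) G)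
    (t β : ℝ) : Integrable (fun x => gr (x * t) β) G := by
  have hx1 : Integrable (fun x : ℝ => x) G :=
    (int_abs G hX).mono' continuous_id.aestronglyMeasurable (Filter.Eventually.of_forall fun x => le_rfl)
  have i1 : Integrable (fun x => (1 - gQ (x * t) β) * (x ^ 2 * t ^ 2)) G :=
    (hX.mul_const (t^2)).bdd_mul (continuous_const.sub (gQ_cont t β)).aestronglyMeasurable
      (Filter.Eventually.of_forall fun x => one_sub_gQ_abs _ _)
  have i2 : Integrable (fun x => gQ (x * t) β * (1 + β ^ 2)) G :=
    (integrable_const _).bdd_mul (gQ_cont t β).aestronglyMeasurable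
      (Filter.Eventually.of_forall fun x => gQ_abs _ _)
  have i3 : Integrable (fun x => gaussPDF (β - x * t) * (β + x * t)) G :=
    ((integrable_const _).add (hx1.mul_const t)).bdd_mul (gp_cont' t β).aestronglyMeasurable
      (Filter.Eventually.of_forall fun x => gp_abs _)
  have i4 : Integrable (fun x => gaussPDF (β + x * t) * (β - x * t)) G :=
    ((integrable_const _).sub (hx1.mul_const t)).bdd_mul (gp_cont'' t β).aestronglyMeasurable
      (Filter.Eventually.of_forall fun x => gp_abs _)
  refine (((i1.add i2).sub i3).sub i4).congr (Filter.Eventually.of_forall fun x => ?_)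
  simp only [Pi.add_apply, Pi.sub_apply, gr]; ring

lemma derivR (G : Measure ℝ) [IsProbabilityMeasure G] (hX : Integrable (fun x => x ^ 2) G)
    (t : ℝ → ℝ) (t' β : ℝ) (ht : HasDerivAt t t' β) :
    Integrable (fun x => 2 * x ^ 2 * t β * (1 - gQ (x * t β) β)) G ∧
    Integrable (fun x => 2 * (β * gQ (x * t β) β - (gaussPDF (β - x * t β) + gaussPDF (β + x * t β)))) G ∧
    HasDerivAt (fun β => ∫ x, gr (x * t β) β ∂G)
      (t' * ∫ x, 2 * x ^ 2 * t β * (1 - gQ (x * t β) β) ∂G +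
        ∫ x, 2 * (β * gQ (x * t β) β - (gaussPDF (β - x * t β) + gaussPDF (β + x * t β))) ∂G) β := by
  refine gen_deriv G (fun v x => gr (x * v.1) v.2)
    (fun v x => 2 * x ^ 2 * v.1 * (1 - gQ (x * v.1) v.2))
    (fun v x => 2 * (v.2 * gQ (x * v.1) v.2 - (gaussPDF (v.2 - x * v.1) + gaussPDF (v.2 + x * v.1))))
    (fun x => x ^ 2 * (2 * (|t β| + 1)) + 2 * ((|β| + 1) * 2 + 2)) t t' β ht (fun v x => gr_fd x v)
    (fun v => ?_)
    (fun v => (by fun_prop : Continuous fun x : ℝ => 2 * x ^ 2 * v.1).mul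
      (continuous_const.sub (gQ_cont _ _)))
    (fun v => continuous_const.mul ((continuous_const.mul (gQ_cont _ _)).sub
      ((gp_cont' _ _).add (gp_cont'' _ _)))) (gr_int G hX _ _)
    ((hX.mul_const _).add (integrable_const _)) ?_
  · have := gQ_cont v.1 v.2
    have := gp_cont' v.1 v.2
    have := gp_cont'' v.1 v.2
    simp only [gr]
    fun_prop
  · intro v hv x
    obtain ⟨h1, h2⟩ := ball_bd _ _ hv
    simp only at h1 h2
    have g1 := gp_abs (v.2 - x * v.1)
    have g2 := gp_abs (v.2 + x * v.1)
    have g3 := abs_add_le (gaussPDF (v.2 - x * v.1)) (gaussPDF (v.2 + x * v.1))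
    have g4 := gQ_abs (x * v.1) v.2
    have g5 := one_sub_gQ_abs (x * v.1) v.2
    have e1 : |2 * x ^ 2 * v.1 * (1 - gQ (x * v.1) v.2)| ≤ x ^ 2 * (2 * (|t β| + 1)) := by
      rw [abs_mul, abs_mul, abs_mul, abs_two, abs_of_nonneg (sq_nonneg x)]
      calc _ ≤ 2 * x ^ 2 * (|t β| + 1) * 1 := by gcongr
        _ = _ := by ring
    have e2 : |2 * (v.2 * gQ (x * v.1) v.2 - (gaussPDF (v.2 - x * v.1) + gaussPDF (v.2 + x * v.1)))|
        ≤ 2 * ((|β| + 1) * 2 + 2) := by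
      rw [abs_mul, abs_two]
      have := abs_sub (v.2 * gQ (x * v.1) v.2) (gaussPDF (v.2 - x * v.1) + gaussPDF (v.2 + x * v.1))
      rw [abs_mul] at this
      have : |v.2| * |gQ (x * v.1) v.2| ≤ (|β| + 1) * 2 := by gcongr
      linarith
    linarith

lemma core (G : Measure ℝ) [IsProbabilityMeasure G] (hX : Integrable (fun x => x ^ 2) G)
    (c : ℝ) (hc : 0 < c) (d : ℝ) (t : ℝ → ℝ) (t' β : ℝ) (hβ : 0 < β) (htpos : 0 < t β)
    (ht : HasDerivAt t t' β)
    (hfix : ∀ b, 0 < b → d = c * t b ^ 2 + ∫ x, gr (x * t b) b ∂G) :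
    ∃ D, D < 0 ∧ HasDerivAt (fun β => ∫ x, gQ (x * t β) β ∂G) D β := by
  obtain ⟨ia, ib, hQ⟩ := derivQ G hX t t' β ht
  obtain ⟨ja, jb, hR⟩ := derivR G hX t t' β ht
  refine ⟨_, ?_, hQ⟩
  have hconst : HasDerivAt (fun b => c * t b ^ 2 + ∫ x, gr (x * t b) b ∂G) 0 β := by
    refine (hasDerivAt_const β d).congr_of_eventuallyEq ?_
    filter_upwards [lt_mem_nhds hβ] with b hb
    exact (hfix b hb).symm
  have heq := (((ht.pow 2).const_mul c).add hR).unique hconst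
  have iq : Integrable (fun x => gQ (x * t β) β) G :=
    (integrable_const (2:ℝ)).mono' (gQ_cont _ _).aestronglyMeasurable
      (Filter.Eventually.of_forall fun x => gQ_abs _ _)
  have ip : Integrable (fun x => gaussPDF (β - x * t β) + gaussPDF (β + x * t β)) G := by
    exact ib.neg.congr (Filter.Eventually.of_forall fun x => by simp only [Pi.neg_apply]; ring)
  set A := ∫ x, (gaussPDF (β - x * t β) + gaussPDF (β + x * t β)) ∂G with hA
  set P := ∫ x, gQ (x * t β) β ∂G with hP
  set B := ∫ x, x * (gaussPDF (β - x * t β) - gaussPDF (β + x * t β)) ∂G with hB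
  set E := ∫ x, 2 * x ^ 2 * t β * (1 - gQ (x * t β) β) ∂G with hE
  have hApos : 0 < A := by
    rw [hA, integral_pos_iff_support_of_nonneg (fun x => by
      have := gp_pos (β - x * t β); have := gp_pos (β + x * t β); simp only [Pi.zero_apply]; linarith) ip]
    have : Function.support (fun x => gaussPDF (β - x * t β) + gaussPDF (β + x * t β)) = Set.univ := by
      ext x
      have := gp_pos (β - x * t β); have := gp_pos (β + x * t β)
      simp only [Function.mem_support, Set.mem_univ, iff_true]; linarith
    rw [this]; simp
  have hPn : 0 ≤ P := integral_nonneg fun x => gQ_nonneg _ _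
  have hBn : 0 ≤ B := integral_nonneg fun x => by
    have := diff_nonneg (x * t β) β hβ.le
    simp only [Pi.zero_apply]
    refine nonneg_of_mul_nonneg_right (a := t β) ?_ htpos
    linarith
  have hBE : 2 * B ≤ E := by
    rw [hB, ← integral_const_mul]
    refine integral_mono (ia.const_mul 2) ja fun x => ?_
    have := key_ineq (x * t β) β hβ.le
    simp only
    refine le_of_mul_le_mul_left ?_ htpos
    linarith
  rw [integral_const_mul, integral_sub (iq.const_mul β) ip, integral_const_mul] at heq
  rw [integral_neg]
  change t' * B + -A < 0
  rw [← hA, ← hP] at heq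
  simp only [Nat.cast_ofNat, Nat.add_one_sub_one, pow_one] at heq
  have hK : 0 < 2 * c * t β + E - 2 * B := by have := mul_pos hc htpos; linarith
  have h1 : t' * (2 * c * t β + E) = 2 * (A - β * P) := by linarith
  have h2 : 0 < 2 * c * t β + E := by linarith
  have h3 : (t' * B - A) * (2 * c * t β + E) < 0 := by
    have : (t' * B - A) * (2 * c * t β + E) = -(2 * (β * P * B)) - A * (2 * c * t β + E - 2 * B) := by
      linear_combination B * h1
    have := mul_pos hApos hK
    have := mul_nonneg (mul_nonneg hβ.le hPn) hBn
    linarith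
  have := neg_of_mul_neg_left h3 h2.le
  linarith

/-- under the state-evolution fixed-point setup, the detection probability
`β ↦ P(|X + σ(β)Z| > β·σ(β))` is strictly decreasing in `β`, with negative derivative. -/
theorem detection_prob_strictAnti (G : Measure ℝ) [IsProbabilityMeasure G]
    (hX : Integrable (fun x => x ^ 2) G)
    (δ σw : ℝ) (hδ : 0 < δ) (hδ1 : δ ≤ 1) (hσw : 0 < σw)
    (σ : ℝ → ℝ) (hσpos : ∀ β : ℝ, 0 < β → 0 < σ β)
    (hσdiff : ∀ β : ℝ, 0 < β → DifferentiableAt ℝ σ β)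
    (hfix : ∀ β : ℝ, 0 < β →
      (σ β) ^ 2 = σw ^ 2 +
        (1 / δ) * ∫ x, (∫ z, (softThr (x + σ β * z) (β * σ β) - x) ^ 2 * gaussPDF z) ∂G) :
    StrictAntiOn
      (fun β : ℝ => ∫ x, (∫ z in {z : ℝ | β * σ β < |x + σ β * z|}, gaussPDF z) ∂G)
      (Set.Ioi 0) ∧
    ∀ β : ℝ, 0 < β →
      deriv (fun β : ℝ => ∫ x, (∫ z in {z : ℝ | β * σ β < |x + σ β * z|}, gaussPDF z) ∂G) β
        < 0 := by
  have ht : ∀ β, 0 < β → HasDerivAt (fun b => (σ b)⁻¹) (-deriv σ β / σ β ^ 2) β := fun β hβ =>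
    (hσdiff β hβ).hasDerivAt.inv (hσpos β hβ).ne'
  have hfix' : ∀ b, 0 < b → δ = (δ * σw ^ 2) * ((σ b)⁻¹) ^ 2 + ∫ x, gr (x * (σ b)⁻¹) b ∂G := by
    intro b hb
    have h := hfix b hb
    have hs := hσpos b hb
    simp only [risk_scaled _ _ _ hs hb] at h
    rw [integral_const_mul] at h
    field_simp at h ⊢
    linarith
  have hcore : ∀ β, 0 < β → ∃ D, D < 0 ∧ HasDerivAt
      (fun β : ℝ => ∫ x, (∫ z in {z : ℝ | β * σ β < |x + σ β * z|}, gaussPDF z) ∂G) D β := by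
    intro β hβ
    obtain ⟨D, hD, h⟩ := core G hX (δ * σw ^ 2) (by positivity) δ (fun b => (σ b)⁻¹) _ β hβ
      (inv_pos.2 (hσpos β hβ)) (ht β hβ) hfix'
    refine ⟨D, hD, h.congr_of_eventuallyEq ?_⟩
    filter_upwards [lt_mem_nhds hβ] with b hb
    simp only [det_scaled _ _ _ (hσpos b hb) hb]
  have hneg : ∀ β : ℝ, 0 < β →
      deriv (fun β : ℝ => ∫ x, (∫ z in {z : ℝ | β * σ β < |x + σ β * z|}, gaussPDF z) ∂G) β
        < 0 := by
    intro β hβ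
    obtain ⟨D, hD, h⟩ := hcore β hβ
    rw [h.deriv]; exact hD
  refine ⟨strictAntiOn_of_deriv_neg (convex_Ioi 0) ?_ ?_, hneg⟩
  · intro β hβ
    obtain ⟨D, hD, h⟩ := hcore β hβ
    exact h.continuousAt.continuousWithinAt
  · intro β hβ
    rw [interior_Ioi] at hβ
    exact hneg β hβ
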